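/- Risky optimality: consider a balanced MDP, let α ∈ (0,1), and let Q₁^risky be the unique fixed point of T^risky_α. Then for all (x,a) ∈ X×A, Q₁^risky(x,a) = inf_{π∈Π} Q₁^π(x,a), where Q₁^π is the first component of the unique fixed point 𝒬^π = (Q₁^π, Q₂^π) of the diatomic Bellman operator T^π_α; equivalently, setting Q₂^risky(x,a) = (V^*(x) − αQ₁^risky(x,a))/(1−α), one has Q₂^risky(x,a) = sup_{π∈Π} Q₂^π(x,a). -/

import Mathlib

open MeasureTheory ProbabilityTheory Finset Set

noncomputable section

/-- Quantile (generalized inverse distribution) function of a measure on `ℝ`. -/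
def quantileFn (ν : Measure ℝ) (τ : ℝ) : ℝ :=
  sInf {z : ℝ | τ ≤ cdf ν z}

/-- Left average value-at-risk at level `α`. -/
def avarLeft (α : ℝ) (ν : Measure ℝ) : ℝ :=
  (1 / α) * ∫ τ in (0:ℝ)..α, quantileFn ν τ

/-- Right average value-at-risk at level `1 - α`. -/
def avarRight (α : ℝ) (ν : Measure ℝ) : ℝ :=
  (1 / (1 - α)) * ∫ τ in α..(1:ℝ), quantileFn ν τ

/-- A measure on `ℝ` with bounded support. -/
def HasBoundedSupport (ν : Measure ℝ) : Prop :=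
  ∃ a b : ℝ, ν (Set.Icc a b)ᶜ = 0

/-- Finite Markov decision process with fixed state and action spaces. -/
structure MDP (X A : Type) [Fintype X] [Fintype A] where
  P : X → A → X → ℝ
  r : X → A → X → ℝ
  γ : ℝ
  P_nonneg : ∀ x a x', 0 ≤ P x a x'
  P_sum_one : ∀ x a, ∑ x', P x a x' = 1
  γ_nonneg : 0 ≤ γ
  γ_lt_one : γ < 1

variable {X A : Type} [Fintype X] [Fintype A]

/-- A stationary Markovian policy. -/
def IsPolicy (π : X → A → ℝ) : Prop :=
  (∀ x a, 0 ≤ π x a) ∧ ∀ x, ∑ a, π x a = 1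

/-- The discrete measure `(T^π D_{α,Q})^{(x,a)}`. -/
def diatomicMeasure (M : MDP X A) (α : ℝ) (π : X → A → ℝ)
    (Q : X → A → ℝ × ℝ) (x : X) (a : A) : Measure ℝ :=
  ∑ x' : X, ∑ a' : A, ENNReal.ofReal (M.P x a x' * π x' a') •
    (ENNReal.ofReal α • Measure.dirac (M.r x a x' + M.γ * (Q x' a').1)
      + ENNReal.ofReal (1 - α) • Measure.dirac (M.r x a x' + M.γ * (Q x' a').2))

/-- The diatomic Bellman operator `T^π_α`. -/
def diatomicT (M : MDP X A) (α : ℝ) (π : X → A → ℝ)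
    (Q : X → A → ℝ × ℝ) : X → A → ℝ × ℝ :=
  fun x a => (avarLeft α (diatomicMeasure M α π Q x a),
              avarRight α (diatomicMeasure M α π Q x a))

variable [Nonempty A]

/-- The second component `Q₂` determined by `Q₁` in a balanced MDP. -/
def Q2of (α : ℝ) (Vstar : X → ℝ) (Q1 : X → A → ℝ) : X → A → ℝ :=
  fun x a => (Vstar x - α * Q1 x a) / (1 - α)

/-- The MDP is balanced: `Q^*(x,a) = V^*(x)` for all `(x,a)`, i.e. `V^*` solves the
Bellman optimality equation with all actions optimal. -/
def IsBalanced (M : MDP X A) (Vstar : X → ℝ) : Prop :=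
  ∀ x a, Vstar x = ∑ x', M.P x a x' * (M.r x a x' + M.γ * Vstar x')

/-- The discrete measure appearing in the safe Bellman operator. -/
def safeMeasure (M : MDP X A) (α : ℝ) (Vstar : X → ℝ) (Q1 : X → A → ℝ)
    (x : X) (a : A) : Measure ℝ :=
  ∑ x' : X, ENNReal.ofReal (M.P x a x') •
    (ENNReal.ofReal α • Measure.dirac (M.r x a x' + M.γ * ⨆ a', Q1 x' a')
      + ENNReal.ofReal (1 - α) •
          Measure.dirac (M.r x a x' + M.γ * ⨅ a', Q2of α Vstar Q1 x' a'))

/-- The discrete measure appearing in the risky Bellman operator. -/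
def riskyMeasure (M : MDP X A) (α : ℝ) (Vstar : X → ℝ) (Q1 : X → A → ℝ)
    (x : X) (a : A) : Measure ℝ :=
  ∑ x' : X, ENNReal.ofReal (M.P x a x') •
    (ENNReal.ofReal α • Measure.dirac (M.r x a x' + M.γ * ⨅ a', Q1 x' a')
      + ENNReal.ofReal (1 - α) •
          Measure.dirac (M.r x a x' + M.γ * ⨆ a', Q2of α Vstar Q1 x' a'))

/-- The safe Bellman operator `T^safe_α`. -/
def Tsafe (M : MDP X A) (α : ℝ) (Vstar : X → ℝ) (Q1 : X → A → ℝ) : X → A → ℝ :=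
  fun x a => avarLeft α (safeMeasure M α Vstar Q1 x a)

/-- The risky Bellman operator `T^risky_α`. -/
def Trisky (M : MDP X A) (α : ℝ) (Vstar : X → ℝ) (Q1 : X → A → ℝ) : X → A → ℝ :=
  fun x a => avarLeft α (riskyMeasure M α Vstar Q1 x a)

section Quantile

variable {ν : Measure ℝ}

/-- Galois connection between the quantile function and the distribution function. -/
theorem quantileFn_le_iff {τ : ℝ} (hτ : τ ∈ Set.Ioo (0 : ℝ) 1) (z : ℝ) :
    quantileFn ν τ ≤ z ↔ τ ≤ cdf ν z := by
  have hne : {z : ℝ | τ ≤ cdf ν z}.Nonempty := by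
    obtain ⟨y, hy⟩ := ((tendsto_cdf_atTop ν).eventually (lt_mem_nhds hτ.2)).exists
    exact ⟨y, hy.le⟩
  have hbdd : BddBelow {z : ℝ | τ ≤ cdf ν z} := by
    obtain ⟨y, hy⟩ := ((tendsto_cdf_atBot ν).eventually (gt_mem_nhds hτ.1)).exists
    refine ⟨y, fun w hw => ?_⟩
    by_contra! h
    exact absurd (hw.trans (monotone_cdf ν h.le)) (not_le.mpr hy)
  constructor
  · intro h
    have hr : Filter.Tendsto (cdf ν) (nhdsWithin z (Set.Ioi z)) (nhds (cdf ν z)) :=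
      ((cdf ν).right_continuous z).mono_left (nhdsWithin_mono _ Set.Ioi_subset_Ici_self)
    refine ge_of_tendsto hr ?_
    filter_upwards [self_mem_nhdsWithin] with y hy
    obtain ⟨w, hw, hwy⟩ := exists_lt_of_csInf_lt hne (lt_of_le_of_lt h hy)
    exact le_trans hw (monotone_cdf ν hwy.le)
  · intro h
    exact csInf_le hbdd h

theorem monotoneOn_quantileFn : MonotoneOn (quantileFn ν) (Set.Ioo 0 1) := by
  intro σ hσ τ hτ h
  exact (quantileFn_le_iff hσ _).2 (h.trans ((quantileFn_le_iff hτ _).1 le_rfl))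

theorem aemeasurable_quantileFn :
    AEMeasurable (quantileFn ν) (volume.restrict (Set.Ioo (0 : ℝ) 1)) :=
  aemeasurable_restrict_of_monotoneOn measurableSet_Ioo monotoneOn_quantileFn

variable [IsProbabilityMeasure ν]

/-- The quantile function pushes the uniform distribution forward to `ν`. -/
theorem map_quantileFn : (volume.restrict (Set.Ioo (0 : ℝ) 1)).map (quantileFn ν) = ν := by
  have hm := aemeasurable_quantileFn (ν := ν)
  have : IsFiniteMeasure ((volume.restrict (Set.Ioo (0 : ℝ) 1)).map (quantileFn ν)) :=
    inferInstance
  refine Measure.ext_of_Iic _ _ fun z => ?_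
  rw [Measure.map_apply_of_aemeasurable hm measurableSet_Iic,
    Measure.restrict_apply₀' measurableSet_Ioo.nullMeasurableSet]
  have hset : quantileFn ν ⁻¹' Set.Iic z ∩ Set.Ioo 0 1 = Set.Iic (cdf ν z) ∩ Set.Ioo 0 1 := by
    ext τ
    simp only [Set.mem_inter_iff, Set.mem_preimage, Set.mem_Iic]
    exact ⟨fun h => ⟨(quantileFn_le_iff h.2 z).1 h.1, h.2⟩,
      fun h => ⟨(quantileFn_le_iff h.2 z).2 h.1, h.2⟩⟩
  rw [hset, ← ofReal_cdf]
  have h0 := cdf_nonneg ν z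
  have h1 := cdf_le_one ν z
  apply le_antisymm
  · calc volume (Set.Iic (cdf ν z) ∩ Set.Ioo 0 1) ≤ volume (Set.Icc 0 (cdf ν z)) :=
          measure_mono fun τ h => ⟨h.2.1.le, h.1⟩
      _ = _ := by simp
  · calc ENNReal.ofReal (cdf ν z) = volume (Set.Ioo 0 (cdf ν z)) := by simp
      _ ≤ volume (Set.Iic (cdf ν z) ∩ Set.Ioo 0 1) :=
          measure_mono fun τ h => ⟨h.2.le, h.1, h.2.trans_le h1⟩

theorem integrableOn_comp_quantileFn {f : ℝ → ℝ} (hf : Integrable f ν) :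
    IntegrableOn (fun τ => f (quantileFn ν τ)) (Set.Ioo 0 1) := by
  rw [← map_quantileFn (ν := ν)] at hf
  exact hf.comp_aemeasurable aemeasurable_quantileFn

theorem intervalIntegral_comp_quantileFn {f : ℝ → ℝ} (hf : Integrable f ν) :
    ∫ τ in (0 : ℝ)..1, f (quantileFn ν τ) = ∫ z, f z ∂ν := by
  rw [intervalIntegral.integral_of_le zero_le_one, integral_Ioc_eq_integral_Ioo,
    ← integral_map aemeasurable_quantileFn
      (by rw [map_quantileFn]; exact hf.aestronglyMeasurable), map_quantileFn]

theorem intervalIntegrable_comp_quantileFn {f : ℝ → ℝ} (hf : Integrable f ν) {a b : ℝ}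
    (ha : 0 ≤ a) (hab : a ≤ b) (hb : b ≤ 1) :
    IntervalIntegrable (fun τ => f (quantileFn ν τ)) volume a b := by
  rw [intervalIntegrable_iff_integrableOn_Ioo_of_le hab]
  exact (integrableOn_comp_quantileFn hf).mono_set (Set.Ioo_subset_Ioo ha hb)

theorem integrable_max_sub (hν : Integrable id ν) (t : ℝ) :
    Integrable (fun z => max (t - z) 0) ν :=
  ((integrable_const t).sub hν).pos_part

variable {α : ℝ}

theorem avarLeft_add_avarRight (hα : α ∈ Set.Ioo (0 : ℝ) 1) (hν : Integrable id ν) :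
    α * avarLeft α ν + (1 - α) * avarRight α ν = ∫ z, z ∂ν := by
  have h1 : 1 - α ≠ 0 := (sub_pos.2 hα.2).ne'
  have h0 : α ≠ 0 := hα.1.ne'
  have hmean := intervalIntegral_comp_quantileFn hν
  have hsplit := intervalIntegral.integral_add_adjacent_intervals
    (intervalIntegrable_comp_quantileFn hν le_rfl hα.1.le hα.2.le)
    (intervalIntegrable_comp_quantileFn hν hα.1.le hα.2.le le_rfl)
  simp only [id] at hmean hsplit
  rw [← hmean, ← hsplit, avarLeft, avarRight]
  field_simp

theorem le_mul_avarLeft (hα : α ∈ Set.Ioo (0 : ℝ) 1) (hν : Integrable id ν) (t : ℝ) :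
    α * t - ∫ z, max (t - z) 0 ∂ν ≤ α * avarLeft α ν := by
  have hpos := integrable_max_sub hν t
  have hq := intervalIntegrable_comp_quantileFn hν le_rfl hα.1.le hα.2.le
  have hp := intervalIntegrable_comp_quantileFn hpos le_rfl hα.1.le hα.2.le
  have hp' := intervalIntegrable_comp_quantileFn hpos hα.1.le hα.2.le le_rfl
  have h1 : ∫ τ in (0 : ℝ)..α, (t - quantileFn ν τ) ≤
      ∫ τ in (0 : ℝ)..α, max (t - quantileFn ν τ) 0 :=
    intervalIntegral.integral_mono_on hα.1.le (intervalIntegrable_const.sub hq) hp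
      fun τ _ => le_max_left _ _
  have h2 : 0 ≤ ∫ τ in α..(1 : ℝ), max (t - quantileFn ν τ) 0 :=
    intervalIntegral.integral_nonneg hα.2.le fun τ _ => le_max_right _ _
  have h3 := intervalIntegral.integral_add_adjacent_intervals hp hp'
  have h4 := intervalIntegral_comp_quantileFn hpos
  have h5 : ∫ τ in (0 : ℝ)..α, (t - quantileFn ν τ) =
      α * t - ∫ τ in (0 : ℝ)..α, quantileFn ν τ := by
    have := intervalIntegral.integral_sub (intervalIntegrable_const (c := t)) hq
    simpa using this
  have h6 : α * avarLeft α ν = ∫ τ in (0 : ℝ)..α, quantileFn ν τ := by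
    rw [avarLeft, ← mul_assoc, mul_one_div_cancel hα.1.ne', one_mul]
  linarith

theorem mul_avarLeft_eq (hα : α ∈ Set.Ioo (0 : ℝ) 1) (hν : Integrable id ν) :
    α * avarLeft α ν =
      α * quantileFn ν α - ∫ z, max (quantileFn ν α - z) 0 ∂ν := by
  set t := quantileFn ν α with ht
  have hpos := integrable_max_sub hν t
  have hq := intervalIntegrable_comp_quantileFn hν le_rfl hα.1.le hα.2.le
  have hp := intervalIntegrable_comp_quantileFn hpos le_rfl hα.1.le hα.2.le
  have hp' := intervalIntegrable_comp_quantileFn hpos hα.1.le hα.2.le le_rfl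
  have h1 : ∫ τ in (0 : ℝ)..α, max (t - quantileFn ν τ) 0 =
      ∫ τ in (0 : ℝ)..α, (t - quantileFn ν τ) := by
    rw [intervalIntegral.integral_of_le hα.1.le, intervalIntegral.integral_of_le hα.1.le]
    refine setIntegral_congr_fun measurableSet_Ioc fun τ hτ => max_eq_left (sub_nonneg.2 ?_)
    exact monotoneOn_quantileFn ⟨hτ.1, hτ.2.trans_lt hα.2⟩ hα hτ.2
  have h2 : ∫ τ in α..(1 : ℝ), max (t - quantileFn ν τ) 0 = 0 := by
    rw [intervalIntegral.integral_of_le hα.2.le, integral_Ioc_eq_integral_Ioo]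
    refine setIntegral_eq_zero_of_forall_eq_zero fun τ hτ => max_eq_right (sub_nonpos.2 ?_)
    exact monotoneOn_quantileFn hα ⟨hα.1.trans hτ.1, hτ.2⟩ hτ.1.le
  have h3 := intervalIntegral.integral_add_adjacent_intervals hp hp'
  have h4 := intervalIntegral_comp_quantileFn hpos
  have h5 : ∫ τ in (0 : ℝ)..α, (t - quantileFn ν τ) =
      α * t - ∫ τ in (0 : ℝ)..α, quantileFn ν τ := by
    have := intervalIntegral.integral_sub (intervalIntegrable_const (c := t)) hq
    simpa using this
  have h6 : α * avarLeft α ν = ∫ τ in (0 : ℝ)..α, quantileFn ν τ := by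
    rw [avarLeft, ← mul_assoc, mul_one_div_cancel hα.1.ne', one_mul]
  linarith

theorem avarLeft_le_integral (hα : α ∈ Set.Ioo (0 : ℝ) 1) (hν : Integrable id ν) :
    avarLeft α ν ≤ ∫ z, z ∂ν := by
  have h := mul_avarLeft_eq hα hν
  set t := quantileFn ν α
  have hpos := integrable_max_sub hν t
  have h1 : ∫ z, α * (t - z) ∂ν ≤ ∫ z, max (t - z) 0 ∂ν := by
    refine integral_mono (((integrable_const t).sub hν).const_mul α) hpos fun z => ?_
    have h0 := le_max_right (t - z) 0
    have h2 := le_max_left (t - z) 0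
    have := mul_le_mul_of_nonneg_left h2 hα.1.le
    have := mul_le_mul_of_nonneg_right hα.2.le h0
    dsimp only
    linarith
  have h2 : ∫ z, α * (t - z) ∂ν = α * (t - ∫ z, z ∂ν) := by
    have := integral_sub (integrable_const t) hν
    simp only [id] at this
    rw [integral_const_mul, this]
    simp
  have h3 : α * avarLeft α ν ≤ α * ∫ z, z ∂ν := by linarith
  exact le_of_mul_le_mul_left h3 hα.1

end Quantile

section Diatomic

variable {X A : Type} [Fintype X] [Fintype A] {M : MDP X A} {α : ℝ} {π : X → A → ℝ}

theorem isProbabilityMeasure_diatomicMeasure (M : MDP X A) (hα : α ∈ Set.Ioo (0 : ℝ) 1)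
    (hπ : IsPolicy π) (Q : X → A → ℝ × ℝ) (x : X) (a : A) :
    IsProbabilityMeasure (diatomicMeasure M α π Q x a) := by
  constructor
  have hone : ENNReal.ofReal α + ENNReal.ofReal (1 - α) = 1 := by
    rw [← ENNReal.ofReal_add hα.1.le (sub_nonneg.2 hα.2.le)]
    simp
  simp only [diatomicMeasure, Measure.coe_finsetSum, Finset.sum_apply, Measure.smul_apply,
    Measure.add_apply, measure_univ, smul_eq_mul, mul_one, hone]
  have hsum : ∑ x', ∑ a', M.P x a x' * π x' a' = 1 := by
    simp only [← Finset.mul_sum, hπ.2, mul_one, M.P_sum_one]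
  have h0 : ∀ x' a', 0 ≤ M.P x a x' * π x' a' := fun x' a' =>
    mul_nonneg (M.P_nonneg _ _ _) (hπ.1 _ _)
  simp_rw [← ENNReal.ofReal_sum_of_nonneg fun a' _ => h0 _ a']
  rw [← ENNReal.ofReal_sum_of_nonneg fun x' _ => Finset.sum_nonneg fun a' _ => h0 x' a', hsum,
    ENNReal.ofReal_one]

theorem integrable_diatomicMeasure (M : MDP X A) (Q : X → A → ℝ × ℝ) (x : X) (a : A)
    (f : ℝ → ℝ) : Integrable f (diatomicMeasure M α π Q x a) := by
  have hd : ∀ y : ℝ, Integrable f (Measure.dirac y) := fun y => integrable_dirac (by simp)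
  refine integrable_finsetSum_measure.2 fun x' _ => integrable_finsetSum_measure.2 fun a' _ => ?_
  exact ((((hd _).smul_measure ENNReal.ofReal_ne_top).add_measure
    ((hd _).smul_measure ENNReal.ofReal_ne_top))).smul_measure ENNReal.ofReal_ne_top

theorem integral_diatomicMeasure (M : MDP X A) (hα : α ∈ Set.Ioo (0 : ℝ) 1)
    (hπ : IsPolicy π) (Q : X → A → ℝ × ℝ) (x : X) (a : A) (f : ℝ → ℝ) :
    ∫ z, f z ∂(diatomicMeasure M α π Q x a) =
      ∑ x', M.P x a x' * ∑ a', π x' a' * (α * f (M.r x a x' + M.γ * (Q x' a').1)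
        + (1 - α) * f (M.r x a x' + M.γ * (Q x' a').2)) := by
  have hd : ∀ y : ℝ, Integrable f (Measure.dirac y) := fun y => integrable_dirac (by simp)
  have hs : ∀ c y : ℝ, Integrable f (ENNReal.ofReal c • Measure.dirac y) := fun c y =>
    (hd y).smul_measure ENNReal.ofReal_ne_top
  have hi : ∀ (c y z : ℝ), Integrable f (ENNReal.ofReal c •
      (ENNReal.ofReal α • Measure.dirac y + ENNReal.ofReal (1 - α) • Measure.dirac z)) :=
    fun c y z => ((hs _ _).add_measure (hs _ _)).smul_measure ENNReal.ofReal_ne_top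
  rw [diatomicMeasure, integral_finsetSum_measure fun x' _ =>
    integrable_finsetSum_measure.2 fun a' _ => hi _ _ _]
  refine Finset.sum_congr rfl fun x' _ => ?_
  rw [integral_finsetSum_measure fun a' _ => hi _ _ _, Finset.mul_sum]
  refine Finset.sum_congr rfl fun a' _ => ?_
  rw [integral_smul_measure, integral_add_measure (hs _ _) (hs _ _), integral_smul_measure,
    integral_smul_measure, integral_dirac, integral_dirac,
    ENNReal.toReal_ofReal (mul_nonneg (M.P_nonneg _ _ _) (hπ.1 _ _)),
    ENNReal.toReal_ofReal hα.1.le, ENNReal.toReal_ofReal (sub_nonneg.2 hα.2.le)]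
  simp only [smul_eq_mul]
  ring

/-- Weighted sums against the joint law of next state and action are bounded by any bound on
the summands. -/
theorem sum_transition_le (M : MDP X A) (hπ : IsPolicy π) (x : X) (a : A) {g : X → A → ℝ} {c : ℝ}
    (hg : ∀ x' a', g x' a' ≤ c) :
    ∑ x', M.P x a x' * ∑ a', π x' a' * g x' a' ≤ c := by
  have h1 : ∀ x', ∑ a', π x' a' * g x' a' ≤ c := fun x' =>
    calc ∑ a', π x' a' * g x' a' ≤ ∑ a', π x' a' * c :=
          Finset.sum_le_sum fun a' _ => mul_le_mul_of_nonneg_left (hg x' a') (hπ.1 _ _)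
      _ = c := by rw [← Finset.sum_mul, hπ.2, one_mul]
  calc ∑ x', M.P x a x' * ∑ a', π x' a' * g x' a' ≤ ∑ x', M.P x a x' * c :=
        Finset.sum_le_sum fun x' _ => mul_le_mul_of_nonneg_left (h1 x') (M.P_nonneg _ _ _)
    _ = c := by rw [← Finset.sum_mul, M.P_sum_one, one_mul]

theorem nonpos_of_contraction {γ : ℝ} (hγ : γ < 1) {D : X → A → ℝ}
    (h : ∀ c, 0 ≤ c → (∀ x a, D x a ≤ c) → ∀ x a, D x a ≤ γ * c) (x : X) (a : A) :
    D x a ≤ 0 := by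
  have : Nonempty (X × A) := ⟨(x, a)⟩
  obtain ⟨p, hp⟩ := Finite.exists_max fun p : X × A => D p.1 p.2
  by_contra! hlt
  have hpos : 0 < D p.1 p.2 := hlt.trans_le (hp (x, a))
  have := h _ hpos.le (fun x a => hp (x, a)) p.1 p.2
  nlinarith

/-- The mean of the diatomic target when the mean of every successor distribution is `V`. -/
theorem integral_diatomicMeasure_of_mean (hα : α ∈ Set.Ioo (0 : ℝ) 1) {V : X → ℝ}
    (hV : IsBalanced M V) (hπ : IsPolicy π) (Q : X → A → ℝ × ℝ) (x : X) (a : A) :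
    ∫ z, z ∂(diatomicMeasure M α π Q x a) = V x + M.γ * ∑ x', M.P x a x' * ∑ a', π x' a' *
      (α * (Q x' a').1 + (1 - α) * (Q x' a').2 - V x') := by
  rw [integral_diatomicMeasure M hα hπ Q x a fun z => z, hV x a, Finset.mul_sum,
    ← Finset.sum_add_distrib]
  refine Finset.sum_congr rfl fun x' _ => ?_
  have hsum : M.r x a x' + M.γ * V x' = ∑ a', π x' a' * (M.r x a x' + M.γ * V x') := by
    rw [← Finset.sum_mul, hπ.2, one_mul]
  rw [hsum, mul_left_comm, ← mul_add, Finset.mul_sum _ _ M.γ, ← Finset.sum_add_distrib]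
  congr 1
  refine Finset.sum_congr rfl fun a' _ => ?_
  ring

theorem mean_eq_of_fixedPoint (hα : α ∈ Set.Ioo (0 : ℝ) 1) {V : X → ℝ}
    (hV : IsBalanced M V) (hπ : IsPolicy π) {Q : X → A → ℝ × ℝ} (hQ : diatomicT M α π Q = Q)
    (x : X) (a : A) : α * (Q x a).1 + (1 - α) * (Q x a).2 = V x := by
  have hrec : ∀ x a, α * (Q x a).1 + (1 - α) * (Q x a).2 - V x =
      M.γ * ∑ x', M.P x a x' * ∑ a', π x' a' *
        (α * (Q x' a').1 + (1 - α) * (Q x' a').2 - V x') := by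
    intro x a
    have := isProbabilityMeasure_diatomicMeasure M hα hπ Q x a
    have h := avarLeft_add_avarRight hα (integrable_diatomicMeasure (α := α) (π := π) M Q x a id)
    rw [integral_diatomicMeasure_of_mean hα hV hπ] at h
    have h1 : (Q x a).1 = avarLeft α (diatomicMeasure M α π Q x a) := by
      conv_lhs => rw [← hQ]
      rfl
    have h2 : (Q x a).2 = avarRight α (diatomicMeasure M α π Q x a) := by
      conv_lhs => rw [← hQ]
      rfl
    conv_lhs => rw [h1, h2]
    linarith
  refine le_antisymm (sub_nonpos.1 ?_) (sub_nonneg.1 (neg_nonpos.1 ?_))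
  · refine nonpos_of_contraction (D := fun x a => α * (Q x a).1 + (1 - α) * (Q x a).2 - V x)
      M.γ_lt_one (fun c _ hc x a => ?_) x a
    rw [hrec]
    exact mul_le_mul_of_nonneg_left (sum_transition_le M hπ x a hc) M.γ_nonneg
  · refine nonpos_of_contraction (D := fun x a => -(α * (Q x a).1 + (1 - α) * (Q x a).2 - V x))
      M.γ_lt_one (fun c _ hc x a => ?_) x a
    rw [hrec, ← mul_neg, ← Finset.sum_neg_distrib]
    simp_rw [← mul_neg, ← Finset.sum_neg_distrib, ← mul_neg]
    exact mul_le_mul_of_nonneg_left (sum_transition_le M hπ x a hc) M.γ_nonneg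

theorem fst_le_of_fixedPoint (hα : α ∈ Set.Ioo (0 : ℝ) 1) {V : X → ℝ}
    (hV : IsBalanced M V) (hπ : IsPolicy π) {Q : X → A → ℝ × ℝ} (hQ : diatomicT M α π Q = Q)
    (x : X) (a : A) : (Q x a).1 ≤ V x := by
  have := isProbabilityMeasure_diatomicMeasure M hα hπ Q x a
  have h := avarLeft_le_integral hα (integrable_diatomicMeasure (α := α) (π := π) M Q x a id)
  rw [integral_diatomicMeasure_of_mean hα hV hπ] at h
  simp only [mean_eq_of_fixedPoint hα hV hπ hQ, sub_self, mul_zero, Finset.sum_const_zero,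
    add_zero] at h
  conv_lhs => rw [← hQ]
  exact h

/-- Lowering the smaller atom of a two-point distribution with fixed mean `V` by at most `c`
increases its expected shortfall by at most `α * (γ * c)`. -/
theorem diatomic_shortfall_sub_le {γ V s q₁ q₂ m₁ m₂ c : ℝ} (hα : α ∈ Set.Ioo (0 : ℝ) 1)
    (hγ : 0 ≤ γ) (hc : 0 ≤ c) (hq : α * q₁ + (1 - α) * q₂ = V) (hqV : q₁ ≤ V)
    (hm : α * m₁ + (1 - α) * m₂ = V) (hd : m₁ - q₁ ≤ c) :
    (α * max (s - γ * q₁) 0 + (1 - α) * max (s - γ * q₂) 0) -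
      (α * max (s - γ * m₁) 0 + (1 - α) * max (s - γ * m₂) 0) ≤ α * (γ * c) := by
  have hβ : 0 < 1 - α := sub_pos.2 hα.2
  have hq₂ : V ≤ q₂ := by
    have := mul_le_mul_of_nonneg_left hqV hα.1.le
    exact le_of_mul_le_mul_left (by linarith) hβ
  have hγc := mul_nonneg hα.1.le (mul_nonneg hγ hc)
  have hM₁ := mul_le_mul_of_nonneg_left (le_max_left (s - γ * m₁) 0) hα.1.le
  have hM₂ := mul_le_mul_of_nonneg_left (le_max_left (s - γ * m₂) 0) hβ.le
  have hM₁' := mul_nonneg hα.1.le (le_max_right (s - γ * m₁) 0)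
  have hM₂' := mul_nonneg hβ.le (le_max_right (s - γ * m₂) 0)
  rcases le_total m₁ q₁ with hle | hle
  · rcases le_total s (γ * q₁) with h1 | h1
    · have h2 : γ * q₁ ≤ γ * q₂ := mul_le_mul_of_nonneg_left (hqV.trans hq₂) hγ
      rw [max_eq_right (by linarith : s - γ * q₁ ≤ 0), max_eq_right (by linarith : s - γ * q₂ ≤ 0)]
      linarith
    · rw [max_eq_left (by linarith : 0 ≤ s - γ * q₁)]
      rcases le_total s (γ * q₂) with h2 | h2
      · rw [max_eq_right (by linarith : s - γ * q₂ ≤ 0)]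
        have := mul_le_mul_of_nonneg_left (mul_le_mul_of_nonneg_left hle hγ) hα.1.le
        linarith
      · rw [max_eq_left (by linarith : 0 ≤ s - γ * q₂)]
        have : γ * (α * q₁ + (1 - α) * q₂) = γ * (α * m₁ + (1 - α) * m₂) := by rw [hq, hm]
        linarith
  · have h2 : m₂ ≤ q₂ := by
      have := mul_le_mul_of_nonneg_left hle hα.1.le
      exact le_of_mul_le_mul_left (by linarith) hβ
    have h3 : max (s - γ * q₂) 0 ≤ max (s - γ * m₂) 0 :=
      max_le_max_right 0 (sub_le_sub_left (mul_le_mul_of_nonneg_left h2 hγ) s)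
    have h4 : max (s - γ * q₁) 0 ≤ max (s - γ * m₁) 0 + γ * c := by
      have := mul_le_mul_of_nonneg_left hd hγ
      refine max_le ?_ (add_nonneg (le_max_right _ _) (mul_nonneg hγ hc))
      linarith [le_max_left (s - γ * m₁) 0]
    have h5 := mul_le_mul_of_nonneg_left h4 hα.1.le
    have h6 := mul_le_mul_of_nonneg_left h3 hβ.le
    linarith

theorem fst_le_fst_of_greedy (hα : α ∈ Set.Ioo (0 : ℝ) 1) {V : X → ℝ}
    (hV : IsBalanced M V) {σ : X → A → ℝ} (hσ : IsPolicy σ) {R : X → A → ℝ × ℝ}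
    (hR : diatomicT M α σ R = R) {g : X → A}
    (hg : ∀ x a, (R x (g x)).1 ≤ (R x a).1)
    (hσg : ∀ x (f : A → ℝ), ∑ a, σ x a * f a = f (g x))
    (hπ : IsPolicy π) {Q : X → A → ℝ × ℝ} (hQ : diatomicT M α π Q = Q) (x : X) (a : A) :
    (R x a).1 ≤ (Q x a).1 := by
  rw [← sub_nonpos]
  refine nonpos_of_contraction (D := fun x a => (R x a).1 - (Q x a).1) M.γ_lt_one
    (fun c hc0 hc x a => ?_) x a
  have := isProbabilityMeasure_diatomicMeasure M hα hπ Q x a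
  have := isProbabilityMeasure_diatomicMeasure M hα hσ R x a
  have hR1 := mul_avarLeft_eq hα (integrable_diatomicMeasure (α := α) (π := σ) M R x a id)
  set t := quantileFn (diatomicMeasure M α σ R x a) α
  have hQ1 := le_mul_avarLeft hα (integrable_diatomicMeasure (α := α) (π := π) M Q x a id) t
  rw [integral_diatomicMeasure M hα hσ R x a fun z => max (t - z) 0] at hR1
  rw [integral_diatomicMeasure M hα hπ Q x a fun z => max (t - z) 0] at hQ1
  have h1 : avarLeft α (diatomicMeasure M α σ R x a) = (R x a).1 := by
    conv_rhs => rw [← hR]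
    rfl
  have h2 : avarLeft α (diatomicMeasure M α π Q x a) = (Q x a).1 := by
    conv_rhs => rw [← hQ]
    rfl
  simp only [hσg] at hR1
  rw [h1] at hR1
  rw [h2] at hQ1
  have key := sum_transition_le M hπ x a (c := α * (M.γ * c)) (g := fun x' a' =>
    (α * max (t - (M.r x a x' + M.γ * (Q x' a').1)) 0 +
      (1 - α) * max (t - (M.r x a x' + M.γ * (Q x' a').2)) 0) -
    (α * max (t - (M.r x a x' + M.γ * (R x' (g x')).1)) 0 +
      (1 - α) * max (t - (M.r x a x' + M.γ * (R x' (g x')).2)) 0)) fun x' a' => by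
    simp only [← sub_sub (t : ℝ) (M.r x a x')]
    exact diatomic_shortfall_sub_le hα M.γ_nonneg hc0 (mean_eq_of_fixedPoint hα hV hπ hQ _ _)
      (fst_le_of_fixedPoint hα hV hπ hQ _ _) (mean_eq_of_fixedPoint hα hV hσ hR _ _)
      ((sub_le_sub_right (hg x' a') _).trans (hc x' a'))
  simp only [mul_sub (π _ _), Finset.sum_sub_distrib, ← Finset.sum_mul, hπ.2, one_mul,
    mul_sub (M.P _ _ _)] at key
  have h3 : α * ((R x a).1 - (Q x a).1) ≤ α * (M.γ * c) := by linarith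
  exact le_of_mul_le_mul_left h3 hα.1

/-- The deterministic policy that plays `g`. -/
def greedyPolicy {X A : Type} (g : X → A) : X → A → ℝ := fun x a =>
  open Classical in if a = g x then 1 else 0

theorem sum_greedyPolicy_mul {X : Type} (g : X → A) (x : X) (f : A → ℝ) :
    ∑ a, greedyPolicy g x a * f a = f (g x) := by
  classical simp [greedyPolicy]

theorem isPolicy_greedyPolicy {X : Type} (g : X → A) : IsPolicy (greedyPolicy g) := by
  refine ⟨fun x a => ?_, fun x => by simpa using sum_greedyPolicy_mul g x fun _ => 1⟩
  unfold greedyPolicy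
  split_ifs <;> norm_num

theorem riskyMeasure_eq_diatomicMeasure [Nonempty A] (hα : α ∈ Set.Ioo (0 : ℝ) 1) (V : X → ℝ)
    (Q₁ : X → A → ℝ) {g : X → A} (hg : ∀ x a, Q₁ x (g x) ≤ Q₁ x a) (x : X) (a : A) :
    riskyMeasure M α V Q₁ x a =
      diatomicMeasure M α (greedyPolicy g) (fun x a => (Q₁ x a, Q2of α V Q₁ x a)) x a := by
  refine Finset.sum_congr rfl fun x' _ => ?_
  have h1 : ⨅ a', Q₁ x' a' = Q₁ x' (g x') :=
    le_antisymm (ciInf_le (Set.finite_range _).bddBelow _) (le_ciInf (hg x'))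
  have h2 : ⨆ a', Q2of α V Q₁ x' a' = Q2of α V Q₁ x' (g x') := by
    refine le_antisymm (ciSup_le fun a' => ?_)
      (le_ciSup (f := fun a' => Q2of α V Q₁ x' a') (Set.finite_range _).bddAbove _)
    exact div_le_div_of_nonneg_right
      (sub_le_sub_left (mul_le_mul_of_nonneg_left (hg x' a') hα.1.le) _) (sub_nonneg.2 hα.2.le)
  rw [h1, h2, Finset.sum_eq_single (g x')]
  · simp [greedyPolicy]
  · intro b _ hb
    simp [greedyPolicy, hb]
  · simp

end Diatomic

theorem stmt18 (M : MDP X A) (α : ℝ) (hα : α ∈ Set.Ioo (0:ℝ) 1)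
    (Vstar : X → ℝ) (hbal : IsBalanced M Vstar)
    (Q1risky : X → A → ℝ) (hfix : Trisky M α Vstar Q1risky = Q1risky) :
    ∀ x a,
      IsGLB {q : ℝ | ∃ (π : X → A → ℝ) (Qpi : X → A → ℝ × ℝ),
          IsPolicy π ∧ diatomicT M α π Qpi = Qpi ∧ q = (Qpi x a).1}
        (Q1risky x a) ∧
      IsLUB {q : ℝ | ∃ (π : X → A → ℝ) (Qpi : X → A → ℝ × ℝ),
          IsPolicy π ∧ diatomicT M α π Qpi = Qpi ∧ q = (Qpi x a).2}
        ((Vstar x - α * Q1risky x a) / (1 - α)) := by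
  choose g hg using fun x => Finite.exists_min (Q1risky x)
  set R : X → A → ℝ × ℝ := fun x a => (Q1risky x a, Q2of α Vstar Q1risky x a) with hRdef
  have hσ : IsPolicy (greedyPolicy g) := isPolicy_greedyPolicy g
  have h1α : 1 - α ≠ 0 := (sub_pos.2 hα.2).ne'
  have hmean : ∀ x a, α * (R x a).1 + (1 - α) * (R x a).2 = Vstar x := fun x a => by
    simp only [hRdef, Q2of]
    field_simp
    ring
  have hfst : ∀ x a, avarLeft α (diatomicMeasure M α (greedyPolicy g) R x a) = Q1risky x a :=
    fun x a => by
      rw [← riskyMeasure_eq_diatomicMeasure hα Vstar Q1risky hg x a]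
      exact congrFun₂ hfix x a
  have hR : diatomicT M α (greedyPolicy g) R = R := by
    funext x a
    have := isProbabilityMeasure_diatomicMeasure M hα hσ R x a
    have h := avarLeft_add_avarRight hα
      (integrable_diatomicMeasure (α := α) (π := greedyPolicy g) M R x a id)
    rw [integral_diatomicMeasure_of_mean hα hbal hσ] at h
    simp only [hmean, sub_self, mul_zero, Finset.sum_const_zero, add_zero, hfst] at h
    refine Prod.ext (hfst x a) ?_
    change avarRight α _ = (Vstar x - α * Q1risky x a) / (1 - α)
    rw [eq_div_iff h1α]
    linarith
  intro x a
  refine ⟨⟨?_, fun b hb => hb ⟨_, R, hσ, hR, rfl⟩⟩, ⟨?_, fun b hb => hb ⟨_, R, hσ, hR, rfl⟩⟩⟩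
  · rintro _ ⟨π, Q, hπ, hQ, rfl⟩
    exact fst_le_fst_of_greedy hα hbal hσ hR hg (sum_greedyPolicy_mul g) hπ hQ x a
  · rintro _ ⟨π, Q, hπ, hQ, rfl⟩
    have h1 : Q1risky x a ≤ (Q x a).1 :=
      fst_le_fst_of_greedy hα hbal hσ hR hg (sum_greedyPolicy_mul g) hπ hQ x a
    rw [le_div_iff₀ (sub_pos.2 hα.2)]
    have h2 := mean_eq_of_fixedPoint hα hbal hπ hQ x a
    have h3 := mul_le_mul_of_nonneg_left h1 hα.1.le
    linarith

end
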